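/- Sufficient separability criterion 5: Let N ≥ 2, let σ be a Hermitian matrix on ℂ² ⊗ ℂ^N, and let α be real with -2N/(3N-1) ≤ α ≤ 1 and α ≠ 0. If the matrix (1/α)·(σ - (N/(N+α))·ε(σ) - (α/((N+α)(2N+α)))·∑_{m=0}^{N-1} ε(S_B^m · σ · (S_B^m)†)) is positive semidefinite, then σ is separable. -/

import Mathlib

open Matrix Kronecker
open scoped ComplexOrder

noncomputable section

/-- A Hermitian matrix on ℂ^M ⊗ ℂ^N is separable if it is a finite sum of Kronecker
products of positive semidefinite matrices. -/
def IsSeparableMat {M N : ℕ} (σ : Matrix (Fin M × Fin N) (Fin M × Fin N) ℂ) : Prop :=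
  ∃ (k : ℕ) (A : Fin k → Matrix (Fin M) (Fin M) ℂ) (B : Fin k → Matrix (Fin N) (Fin N) ℂ),
    (∀ i, (A i).PosSemidef) ∧ (∀ i, (B i).PosSemidef) ∧ σ = ∑ i, A i ⊗ₖ B i

/-- The pinching onto the diagonal in the standard basis. -/
def pinch {ι : Type*} [DecidableEq ι] (X : Matrix ι ι ℂ) : Matrix ι ι ℂ :=
  Matrix.diagonal (fun i => X i i)

/-- The cyclic shift unitary on ℂ^d : S|j⟩ = |j+1 mod d⟩. -/
def shift (d : ℕ) : Matrix (Fin d) (Fin d) ℂ :=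
  fun i j => if (i : ℕ) = ((j : ℕ) + 1) % d then 1 else 0

end

namespace IsSeparableMat

variable {M N : ℕ}

theorem of_kronecker {A : Matrix (Fin M) (Fin M) ℂ} {B : Matrix (Fin N) (Fin N) ℂ}
    (hA : A.PosSemidef) (hB : B.PosSemidef) : IsSeparableMat (A ⊗ₖ B) :=
  ⟨1, fun _ => A, fun _ => B, fun _ => hA, fun _ => hB, by simp⟩

theorem zero : IsSeparableMat (0 : Matrix (Fin M × Fin N) (Fin M × Fin N) ℂ) :=
  ⟨0, fun _ => 0, fun _ => 0, fun _ => .zero, fun _ => .zero, by simp⟩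

theorem add {σ τ : Matrix (Fin M × Fin N) (Fin M × Fin N) ℂ}
    (hσ : IsSeparableMat σ) (hτ : IsSeparableMat τ) : IsSeparableMat (σ + τ) := by
  obtain ⟨k, A, B, hA, hB, rfl⟩ := hσ
  obtain ⟨l, A', B', hA', hB', rfl⟩ := hτ
  refine ⟨k + l, Fin.append A A', Fin.append B B', fun i => ?_, fun i => ?_, ?_⟩
  · induction i using Fin.addCases <;> simp [hA, hA']
  · induction i using Fin.addCases <;> simp [hB, hB']
  · simp [Fin.sum_univ_add]

theorem sum {ι : Type*} (s : Finset ι) {σ : ι → Matrix (Fin M × Fin N) (Fin M × Fin N) ℂ}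
    (h : ∀ i ∈ s, IsSeparableMat (σ i)) : IsSeparableMat (∑ i ∈ s, σ i) :=
  Finset.sum_induction σ IsSeparableMat (fun _ _ => add) zero h

theorem smul {σ : Matrix (Fin M × Fin N) (Fin M × Fin N) ℂ} (hσ : IsSeparableMat σ)
    {c : ℝ} (hc : 0 ≤ c) : IsSeparableMat ((c : ℂ) • σ) := by
  obtain ⟨k, A, B, hA, hB, rfl⟩ := hσ
  refine ⟨k, fun i => (c : ℂ) • A i, B, fun i => (hA i).smul (by exact_mod_cast hc), hB, ?_⟩
  simp [Finset.smul_sum, smul_kronecker]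

theorem conj {M' N' : ℕ} {σ : Matrix (Fin M × Fin N) (Fin M × Fin N) ℂ} (hσ : IsSeparableMat σ)
    (P : Matrix (Fin M') (Fin M) ℂ) (V : Matrix (Fin N') (Fin N) ℂ) :
    IsSeparableMat ((P ⊗ₖ V) * σ * (P ⊗ₖ V)ᴴ) := by
  obtain ⟨k, A, B, hA, hB, rfl⟩ := hσ
  refine ⟨k, fun i => P * A i * Pᴴ, fun i => V * B i * Vᴴ,
    fun i => (hA i).mul_mul_conjTranspose_same P, fun i => (hB i).mul_mul_conjTranspose_same V, ?_⟩
  simp [Matrix.mul_sum, Matrix.sum_mul, mul_kronecker_mul, conjTranspose_kronecker]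

theorem one_kronecker_add_kronecker {R T : Matrix (Fin N) (Fin N) ℂ}
    {G : Matrix (Fin M) (Fin M) ℂ} {g : ℝ} (hg : 0 < g)
    (hG : ((g : ℂ) • 1 + G).PosSemidef) (hG' : ((g : ℂ) • 1 - G).PosSemidef)
    (hR : (R + (g : ℂ) • T).PosSemidef) (hR' : (R - (g : ℂ) • T).PosSemidef) :
    IsSeparableMat (1 ⊗ₖ R + G ⊗ₖ T) := by
  convert ((of_kronecker hG hR).add (of_kronecker hG' hR')).smul
    (show 0 ≤ 1 / (2 * g) by positivity) using 1
  have hg' : (g : ℂ) ≠ 0 := by exact_mod_cast hg.ne'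
  ext ⟨i, j⟩ ⟨k, l⟩
  simp
  field_simp
  ring_nf

end IsSeparableMat

theorem posSemidef_fin_two {a d : ℝ} {b : ℂ} (ha : 0 ≤ a) (hd : 0 ≤ d)
    (h : Complex.normSq b ≤ a * d) :
    (!![(a : ℂ), b; star b, (d : ℂ)]).PosSemidef := by
  rcases ha.eq_or_lt with rfl | ha
  · have hb : b = 0 := by
      rw [← Complex.normSq_eq_zero]
      exact le_antisymm (by simpa using h) (Complex.normSq_nonneg b)
    subst hb
    convert PosSemidef.diagonal (d := ![(0 : ℂ), (d : ℂ)]) ?_ using 1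
    · ext i j; fin_cases i <;> fin_cases j <;> simp
    · intro i; fin_cases i <;> simp [hd]
  · have hdiag : (diagonal ![(0 : ℂ), ((d - Complex.normSq b / a : ℝ) : ℂ)]).PosSemidef := by
      refine PosSemidef.diagonal fun i => ?_
      have : 0 ≤ d - Complex.normSq b / a := by
        rw [sub_nonneg, div_le_iff₀ ha]; linarith
      fin_cases i
      · simp
      · simpa only [Fin.mk_one, Matrix.cons_val_one, Matrix.cons_val_fin_one, Pi.zero_apply,
          Complex.zero_le_real] using this
    have ha' : (0 : ℂ) ≤ ((1 / a : ℝ) : ℂ) := by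
      rw [Complex.zero_le_real]; positivity
    convert ((posSemidef_vecMulVec_self_star ![(a : ℂ), star b]).smul ha').add hdiag using 1
    have ha0 : (a : ℂ) ≠ 0 := by exact_mod_cast ha.ne'
    ext i j
    rw [Matrix.add_apply, Matrix.smul_apply, vecMulVec_apply]
    fin_cases i <;> fin_cases j <;> simp [Complex.normSq_eq_conj_mul_self, ha0]
    field_simp
    ring

/-- The two-qubit block matrix `[[1, K], [Kᴴ, 1]]`, with blocks indexed by the second factor. -/
def contractionBlock (K : Matrix (Fin 2) (Fin 2) ℂ) :
    Matrix (Fin 2 × Fin 2) (Fin 2 × Fin 2) ℂ :=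
  1 ⊗ₖ 1 + K ⊗ₖ !![0, 1; 0, 0] + Kᴴ ⊗ₖ !![0, 0; 1, 0]

theorem isSeparableMat_contractionBlock_quaternion {p q : ℂ}
    (h : Complex.normSq p + Complex.normSq q ≤ 1) :
    IsSeparableMat (contractionBlock !![p, q; -star q, star p]) := by
  have hp := Complex.normSq_apply p
  have hgq : 0 ≤ p.im ^ 2 + Complex.normSq q := add_nonneg (sq_nonneg _) (Complex.normSq_nonneg q)
  obtain ⟨g, hg0, hg⟩ : ∃ g : ℝ, 0 ≤ g ∧ g ^ 2 = p.im ^ 2 + Complex.normSq q :=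
    ⟨_, Real.sqrt_nonneg _, Real.sq_sqrt hgq⟩
  have hblock : contractionBlock !![p, q; -star q, star p] =
      1 ⊗ₖ !![1, (p.re : ℂ); (p.re : ℂ), 1] +
        !![(p.im : ℂ), -Complex.I * q; Complex.I * star q, -(p.im : ℂ)] ⊗ₖ
          !![0, Complex.I; -Complex.I, 0] := by
    have hI : ∀ z : ℂ, Complex.I * z * Complex.I = -z := fun z => by
      linear_combination z * Complex.I_mul_I
    ext ⟨i, j⟩ ⟨k, l⟩
    fin_cases i <;> fin_cases j <;> fin_cases k <;> fin_cases l <;>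
      simp [contractionBlock, hI] <;>
      apply Complex.ext <;> simp
  rw [hblock]
  rcases hg0.eq_or_lt with rfl | hgpos
  · have hq : q = 0 := by
      rw [← Complex.normSq_eq_zero]
      nlinarith [Complex.normSq_nonneg q, sq_nonneg p.im]
    have him : p.im = 0 := by
      nlinarith [Complex.normSq_nonneg q, sq_nonneg p.im]
    have hR : (!![((1 : ℝ) : ℂ), (p.re : ℂ); star (p.re : ℂ), ((1 : ℝ) : ℂ)]).PosSemidef :=
      posSemidef_fin_two zero_le_one zero_le_one (by
        rw [Complex.normSq_ofReal]; nlinarith [Complex.normSq_nonneg q])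
    convert IsSeparableMat.of_kronecker (PosSemidef.one (n := Fin 2) (R := ℂ)) hR using 1
    ext ⟨i, j⟩ ⟨k, l⟩
    fin_cases i <;> fin_cases j <;> fin_cases k <;> fin_cases l <;>
      simp [hq, him]
  · have him : |p.im| ≤ g := by
      apply abs_le_of_sq_le_sq _ hg0
      nlinarith [Complex.normSq_nonneg q]
    obtain ⟨h1, h2⟩ := abs_le.mp him
    refine IsSeparableMat.one_kronecker_add_kronecker hgpos ?_ ?_ ?_ ?_
    · convert posSemidef_fin_two (a := g + p.im) (d := g - p.im) (b := -Complex.I * q)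
        (by linarith) (by linarith) (by simp; nlinarith) using 1
      ext i j; fin_cases i <;> fin_cases j <;> simp [sub_eq_add_neg]
    · convert posSemidef_fin_two (a := g - p.im) (d := g + p.im) (b := Complex.I * q)
        (by linarith) (by linarith) (by simp; nlinarith) using 1
      ext i j; fin_cases i <;> fin_cases j <;> simp
    · convert posSemidef_fin_two (a := 1) (d := 1) (b := p.re + g * Complex.I)
        zero_le_one zero_le_one (by rw [Complex.normSq_add_mul_I]; nlinarith) using 1
      ext i j; fin_cases i <;> fin_cases j <;> simp
    · convert posSemidef_fin_two (a := 1) (d := 1) (b := p.re + (-g : ℝ) * Complex.I)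
        zero_le_one zero_le_one (by rw [Complex.normSq_add_mul_I]; nlinarith) using 1
      ext i j; fin_cases i <;> fin_cases j <;> simp [sub_eq_add_neg]

/-- Every `2 × 2` matrix `K` is `Q + i Q'` with `Q`, `Q'` quaternionic; for `det K = 0` both
parts have the same norm. -/
theorem isSeparableMat_contractionBlock {K : Matrix (Fin 2) (Fin 2) ℂ}
    (hdet : K 0 0 * K 1 1 = K 0 1 * K 1 0)
    (h : ∑ i, ∑ j, Complex.normSq (K i j) ≤ 1) :
    IsSeparableMat (contractionBlock K) := by
  simp only [Fin.sum_univ_two] at h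
  have hre := congrArg Complex.re hdet
  simp only [Complex.mul_re] at hre
  simp only [Complex.normSq_apply] at h
  have h1 := isSeparableMat_contractionBlock_quaternion
    (p := K 0 0 + star (K 1 1)) (q := K 0 1 - star (K 1 0))
    (by simp [Complex.normSq_apply]; nlinarith)
  have h2 := isSeparableMat_contractionBlock_quaternion
    (p := -Complex.I * (K 0 0 - star (K 1 1))) (q := -Complex.I * (K 0 1 + star (K 1 0)))
    (by simp [Complex.normSq_apply]; nlinarith)
  convert (h1.add (h2.conj 1 (diagonal ![1, -Complex.I]))).smul
    (show (0 : ℝ) ≤ 1 / 2 by norm_num) using 1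
  ext ⟨i, j⟩ ⟨k, l⟩
  fin_cases i <;> fin_cases j <;> fin_cases k <;> fin_cases l <;>
    simp [contractionBlock, Matrix.mul_apply, Fintype.sum_prod_type,
      Matrix.one_apply, Matrix.diagonal_apply] <;>
    apply Complex.ext <;> simp <;> ring

/-- The two-qubit block matrix with diagonal blocks `diag (|u|² + |v|²)` and off-diagonal blocks
`α u v†` and `α v u†`. -/
theorem isSeparableMat_pair (u v : Fin 2 → ℂ) {α : ℝ} (hα : |α| ≤ 1) :
    IsSeparableMat (diagonal (fun i => u i * star (u i) + v i * star (v i)) ⊗ₖ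
        (1 : Matrix (Fin 2) (Fin 2) ℂ) +
      (α : ℂ) • (vecMulVec u (star v) ⊗ₖ !![0, 1; 0, 0] +
        vecMulVec v (star u) ⊗ₖ !![0, 0; 1, 0])) := by
  set s : Fin 2 → ℝ := fun i => Real.sqrt (Complex.normSq (u i) + Complex.normSq (v i)) with hs
  have hs2 : ∀ i, s i ^ 2 = Complex.normSq (u i) + Complex.normSq (v i) := fun i =>
    Real.sq_sqrt (add_nonneg (Complex.normSq_nonneg _) (Complex.normSq_nonneg _))
  have hmul : ∀ i, (s i : ℂ) * (u i / s i) = u i ∧ (s i : ℂ) * (v i / s i) = v i := by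
    intro i
    by_cases h0 : s i = 0
    · have := hs2 i
      rw [h0] at this
      have hu : u i = 0 := by
        rw [← Complex.normSq_eq_zero]
        nlinarith [Complex.normSq_nonneg (u i), Complex.normSq_nonneg (v i)]
      have hv : v i = 0 := by
        rw [← Complex.normSq_eq_zero]
        nlinarith [Complex.normSq_nonneg (u i), Complex.normSq_nonneg (v i)]
      simp [hu, hv]
    · have : (s i : ℂ) ≠ 0 := by exact_mod_cast h0
      constructor <;> field_simp
  have hle : ∀ i, Complex.normSq (u i / s i) + Complex.normSq (v i / s i) ≤ 1 := by
    intro i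
    rw [map_div₀, map_div₀, Complex.normSq_ofReal, ← add_div, ← hs2, pow_two]
    exact div_self_le_one _
  obtain ⟨x, hx⟩ : ∃ x : Fin 2 → ℂ, ∀ i, x i = u i / s i := ⟨_, fun _ => rfl⟩
  obtain ⟨y, hy⟩ : ∃ y : Fin 2 → ℂ, ∀ i, y i = v i / s i := ⟨_, fun _ => rfl⟩
  simp only [← hx, ← hy] at hmul hle
  have hK : IsSeparableMat (contractionBlock ((α : ℂ) • vecMulVec x (star y))) := by
    apply isSeparableMat_contractionBlock
    · simp [vecMulVec_apply]; ring
    · have hα2 : α * α ≤ 1 := by nlinarith [abs_le.mp hα]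
      have hxy : (∑ i, Complex.normSq (x i)) * ∑ i, Complex.normSq (y i) ≤ 1 := by
        simp only [Fin.sum_univ_two]
        nlinarith [hle 0, hle 1, sq_nonneg (Complex.normSq (x 0) + Complex.normSq (x 1)
          - Complex.normSq (y 0) - Complex.normSq (y 1)),
          Complex.normSq_nonneg (x 0), Complex.normSq_nonneg (x 1),
          Complex.normSq_nonneg (y 0), Complex.normSq_nonneg (y 1)]
      have hxy0 : 0 ≤ (∑ i, Complex.normSq (x i)) * ∑ i, Complex.normSq (y i) :=
        mul_nonneg (Finset.sum_nonneg fun _ _ => Complex.normSq_nonneg _)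
          (Finset.sum_nonneg fun _ _ => Complex.normSq_nonneg _)
      calc _ = (α * α) * ((∑ i, Complex.normSq (x i)) * ∑ i, Complex.normSq (y i)) := by
            simp [vecMulVec_apply]; ring
        _ ≤ 1 := by nlinarith [mul_self_nonneg α]
  convert hK.conj (diagonal fun i => (s i : ℂ)) (1 : Matrix (Fin 2) (Fin 2) ℂ) using 1
  have hsC : ∀ i, (s i : ℂ) * s i = u i * star (u i) + v i * star (v i) := by
    intro i
    have := congrArg (fun r : ℝ => (r : ℂ)) (hs2 i)
    simp only [Complex.ofReal_pow, Complex.ofReal_add, Complex.normSq_eq_conj_mul_self] at this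
    simp only [Complex.star_def]
    linear_combination this
  have hu : ∀ i, u i = s i * x i := fun i => (hmul i).1.symm
  have hv : ∀ i, v i = s i * y i := fun i => (hmul i).2.symm
  simp only [← hsC]
  ext ⟨i, j⟩ ⟨k, l⟩
  rw [conjTranspose_kronecker, kronecker_one, ← diagonal_one]
  fin_cases i <;> fin_cases j <;> fin_cases k <;> fin_cases l <;>
    simp [contractionBlock, Matrix.mul_apply, Fintype.sum_prod_type,
      Matrix.one_apply, Matrix.diagonal_apply, vecMulVec_apply, hu, hv] <;>
    ring

/-- `isSeparableMat_pair` placed on the coordinates `j`, `l` of the second factor. -/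
theorem isSeparableMat_pair_single {N : ℕ} (u v : Fin 2 → ℂ) (j l : Fin N) {α : ℝ}
    (hα : |α| ≤ 1) :
    IsSeparableMat (diagonal (fun i => u i * star (u i) + v i * star (v i)) ⊗ₖ
        (single j j (1 : ℂ) + single l l 1) +
      (α : ℂ) • (vecMulVec u (star v) ⊗ₖ single j l (1 : ℂ) +
        vecMulVec v (star u) ⊗ₖ single l j (1 : ℂ))) := by
  let V : Matrix (Fin N) (Fin 2) ℂ := of fun n x => if n = ![j, l] x then 1 else 0
  have hV : ∀ B : Matrix (Fin 2) (Fin 2) ℂ, V * B * Vᴴ =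
      single j j (B 0 0) + single j l (B 0 1) + single l j (B 1 0) + single l l (B 1 1) := by
    intro B
    ext n m
    simp only [Matrix.mul_apply, V, Fin.sum_univ_two, of_apply, conjTranspose_apply,
      Matrix.add_apply, single_apply, Matrix.cons_val_zero, Matrix.cons_val_one,
      Matrix.cons_val_fin_one, @eq_comm _ j, @eq_comm _ l]
    by_cases h1 : n = j <;> by_cases h2 : n = l <;> by_cases h3 : m = j <;>
      by_cases h4 : m = l <;> simp [h1, h2, h3, h4] <;> simp_all <;> ring
  have h := (isSeparableMat_pair u v hα).conj (1 : Matrix (Fin 2) (Fin 2) ℂ) V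
  simp only [Matrix.mul_add, Matrix.add_mul, Matrix.mul_smul, Matrix.smul_mul, conjTranspose_kronecker,
    ← mul_kronecker_mul, hV] at h
  simpa using h

/-- The inverse of the linear map in the criterion. -/
def criterionMap {N : ℕ} (α : ℂ) (ρ : Matrix (Fin 2 × Fin N) (Fin 2 × Fin N) ℂ) :
    Matrix (Fin 2 × Fin N) (Fin 2 × Fin N) ℂ :=
  α • ρ + (N : ℂ) • pinch ρ + diagonal fun x => ∑ j, ρ (x.1, j) (x.1, j)

theorem criterionMap_sum {N : ℕ} {ι : Type*} (s : Finset ι) (α : ℂ)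
    (ρ : ι → Matrix (Fin 2 × Fin N) (Fin 2 × Fin N) ℂ) :
    criterionMap α (∑ i ∈ s, ρ i) = ∑ i ∈ s, criterionMap α (ρ i) := by
  ext x y
  by_cases h : x = y
  · subst h
    simp [criterionMap, pinch, Matrix.sum_apply, Finset.sum_add_distrib, Finset.mul_sum]
    exact Finset.sum_comm
  · simp [criterionMap, pinch, Matrix.sum_apply, Finset.mul_sum, h]

theorem isSeparableMat_criterionMap_vecMulVec {N : ℕ} (ψ : Fin 2 × Fin N → ℂ) {α : ℝ}
    (hα : |α| ≤ 1) : IsSeparableMat (criterionMap (α : ℂ) (vecMulVec ψ (star ψ))) := by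
  convert (IsSeparableMat.sum Finset.univ fun j _ => IsSeparableMat.sum Finset.univ fun l _ =>
    isSeparableMat_pair_single (fun i => ψ (i, j)) (fun i => ψ (i, l)) j l hα).smul
    (show (0 : ℝ) ≤ 1 / 2 by norm_num) using 1
  ext ⟨i, n⟩ ⟨k, m⟩
  simp only [criterionMap, pinch, Matrix.add_apply, Matrix.smul_apply, Matrix.sum_apply,
    diagonal_apply, vecMulVec_apply, kronecker_apply, single_apply, Pi.star_apply, smul_eq_mul,
    Prod.mk.injEq]
  by_cases hik : i = k <;> by_cases hnm : n = m <;>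
    simp [hik, hnm, mul_add, Finset.sum_add_distrib, ite_and] <;> ring

theorem isSeparableMat_criterionMap {N : ℕ} {ρ : Matrix (Fin 2 × Fin N) (Fin 2 × Fin N) ℂ}
    (hρ : ρ.PosSemidef) {α : ℝ} (hα : |α| ≤ 1) :
    IsSeparableMat (criterionMap (α : ℂ) ρ) := by
  obtain ⟨k, v, rfl⟩ := posSemidef_iff_eq_sum_vecMulVec.mp hρ
  rw [criterionMap_sum]
  exact IsSeparableMat.sum _ fun i _ => isSeparableMat_criterionMap_vecMulVec (v i) hα

theorem shift_pow_apply {N : ℕ} [NeZero N] (m : ℕ) (i j : Fin N) :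
    (shift N ^ m) i j = if i = j + Fin.ofNat N m then 1 else 0 := by
  have hshift : ∀ a b : Fin N, shift N a b = if a = b + 1 then 1 else 0 := by
    intro a b
    simp [shift, Fin.ext_iff, Fin.val_add]
  induction m generalizing i j with
  | zero => simp [Matrix.one_apply]
  | succ m ih =>
    have hm : Fin.ofNat N (m + 1) = 1 + Fin.ofNat N m := by
      ext
      simp [Fin.val_add, add_comm]
    rw [pow_succ, hm]
    simp [Matrix.mul_apply, ih, hshift, add_assoc]

theorem sum_pinch_shift_pow {N : ℕ} [NeZero N]
    (σ : Matrix (Fin 2 × Fin N) (Fin 2 × Fin N) ℂ) :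
    ∑ m ∈ Finset.range N, pinch ((((1 : Matrix (Fin 2) (Fin 2) ℂ) ⊗ₖ shift N) ^ m) * σ *
        ((((1 : Matrix (Fin 2) (Fin 2) ℂ) ⊗ₖ shift N) ^ m)ᴴ)) =
      diagonal fun x => ∑ j, σ (x.1, j) (x.1, j) := by
  have hpow : ∀ m : ℕ, ((1 : Matrix (Fin 2) (Fin 2) ℂ) ⊗ₖ shift N) ^ m = 1 ⊗ₖ (shift N ^ m) := by
    intro m
    induction m with
    | zero => simp
    | succ m ih => rw [pow_succ, ih, ← mul_kronecker_mul, one_mul, pow_succ]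
  have hdiag : ∀ m : ℕ, pinch ((((1 : Matrix (Fin 2) (Fin 2) ℂ) ⊗ₖ shift N) ^ m) * σ *
        ((((1 : Matrix (Fin 2) (Fin 2) ℂ) ⊗ₖ shift N) ^ m)ᴴ)) =
      diagonal fun x => σ (x.1, x.2 - Fin.ofNat N m) (x.1, x.2 - Fin.ofNat N m) := by
    intro m
    unfold pinch
    congr 1
    ext ⟨i, n⟩
    simp only [hpow, Matrix.mul_apply, Fintype.sum_prod_type, kronecker_apply,
      conjTranspose_apply, shift_pow_apply, Matrix.one_apply, ← sub_eq_iff_eq_add]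
    fin_cases i <;> simp
  simp only [hdiag]
  ext x y
  by_cases h : x = y
  · subst h
    simp only [Matrix.sum_apply, diagonal_apply_eq]
    rw [Finset.sum_range fun m => σ (x.1, x.2 - Fin.ofNat N m) (x.1, x.2 - Fin.ofNat N m)]
    simp only [Fin.ofNat_val_eq_self]
    exact (Equiv.subLeft x.2).sum_comp fun j => σ (x.1, j) (x.1, j)
  · simp [Matrix.sum_apply, h]

/-- Sufficient separability criterion 5. -/
theorem stmt11 {N : ℕ} (hN : 2 ≤ N)
    (σ : Matrix (Fin 2 × Fin N) (Fin 2 × Fin N) ℂ) (hσ : σ.IsHermitian)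
    (α : ℝ) (hα1 : -(2 * (N : ℝ)) / (3 * (N : ℝ) - 1) ≤ α) (hα2 : α ≤ 1) (hα0 : α ≠ 0)
    (hpos : (((α : ℂ))⁻¹ •
        (σ - ((((N : ℝ) / ((N : ℝ) + α) : ℝ)) : ℂ) • pinch σ
          - (((α / (((N : ℝ) + α) * (2 * (N : ℝ) + α)) : ℝ)) : ℂ) •
              ∑ m ∈ Finset.range N,
                pinch ((((1 : Matrix (Fin 2) (Fin 2) ℂ) ⊗ₖ shift N) ^ m) * σ *
                  ((((1 : Matrix (Fin 2) (Fin 2) ℂ) ⊗ₖ shift N) ^ m)ᴴ)))).PosSemidef) :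
    IsSeparableMat σ := by
  have hN2 : (2 : ℝ) ≤ N := by exact_mod_cast hN
  have : NeZero N := ⟨by omega⟩
  have hα : |α| ≤ 1 := by
    refine abs_le.mpr ⟨le_trans ?_ hα1, hα2⟩
    rw [le_div_iff₀ (by linarith)]
    linarith
  have hα' : -1 ≤ α := (abs_le.mp hα).1
  have h1 : (N : ℂ) + α ≠ 0 := by
    have : (N : ℝ) + α ≠ 0 := by linarith
    exact_mod_cast this
  have h2 : (N : ℂ) * 2 + α ≠ 0 := by
    have : (N : ℝ) * 2 + α ≠ 0 := by linarith
    exact_mod_cast this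
  have h0 : (α : ℂ) ≠ 0 := by exact_mod_cast hα0
  rw [sum_pinch_shift_pow] at hpos
  convert isSeparableMat_criterionMap hpos hα using 1
  ext x y
  by_cases h : x = y
  · subst h
    simp [criterionMap, pinch, ← Finset.mul_sum, Finset.sum_sub_distrib]
    generalize ∑ j, σ (x.1, j) (x.1, j) = S
    field_simp
    ring
  · simp [criterionMap, pinch, h, h0]
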